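/- arXiv:2108.12796 — 2 statements merged into one kernel-verified Lean document; each statement's English description precedes it below -/
import Mathlib

section
/- 256/(3π√3) = ∑_{n=0}^∞ (1/16^n) · [(1/2)_n (1/4)_n (3/4)_n (1/6)_n (5/6)_n / ((1)_n³ (4/3)_n (5/3)_n)] · (720n³ + 804n² + 236n + 15). -/
open Real

/-- Pochhammer symbol (x)_n = x (x+1) ⋯ (x+n-1). -/
noncomputable def poch (x : ℝ) (n : ℕ) : ℝ :=
  ∏ k ∈ Finset.range n, (x + k)

/-- ratio in direction `n` -/
noncomputable def trat (n m : ℝ) : ℝ :=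
  (n+1/6)^2*(n+5/6)^2*(m+1/2+n)^2*(1/2+2*n)*(3/2+2*n) /
    ((1+m+n)^2*(m+2/3+2*n)*(m+5/3+2*n)*(m+1/3+2*n)*(m+4/3+2*n)*(1+2*n)*(2+2*n))

/-- ratio in direction `m` -/
noncomputable def mrat (n m : ℝ) : ℝ :=
  (m+1/2+n)^2*(m+1/6)*(m+5/6)/((m+1+n)^2*(m+2/3+2*n)*(m+1/3+2*n))

/-- polynomial factor -/
noncomputable def qnum (n m : ℝ) : ℝ :=
  5/96 + 7/12*m + 47/24*m^2 + 5/2*m^3 + m^4 + n*(89/72 + 167/18*m + 343/18*m^2 + 13*m^3 + 2*m^4)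
    + n^2*(359/36 + 425/9*m + 109/2*m^2 + 16*m^3) + n^3*(104/3 + 94*m + 48*m^2)
    + n^4*(107/2 + 64*m) + 30*n^5

noncomputable def qrat (n m : ℝ) : ℝ :=
  qnum n m / ((m+2/3+2*n)*(1+2*n)*(m+1/3+2*n)*(m+4/3+2*n))

noncomputable def rrat (n m : ℝ) : ℝ := n*(4*n+4*m+1)/(m+1/3+2*n)

noncomputable def kk (m : ℕ) : ℝ := ∏ j ∈ Finset.range m, mrat 0 j

noncomputable def bb (n m : ℕ) : ℝ := kk m * ∏ i ∈ Finset.range n, trat i m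

lemma bb_zero (m : ℕ) : bb 0 m = kk m := by simp [bb]

lemma bb_succ (n m : ℕ) : bb (n+1) m = bb n m * trat n m := by
  simp [bb, Finset.prod_range_succ, mul_assoc]

lemma trat_nonneg (n m : ℕ) : 0 ≤ trat n m := by unfold trat; positivity

lemma mrat_nonneg (n m : ℕ) : 0 ≤ mrat n m := by unfold mrat; positivity

lemma kk_nonneg (m : ℕ) : 0 ≤ kk m := Finset.prod_nonneg fun j _ => by
  have := mrat_nonneg 0 j
  simpa using this

lemma bb_nonneg (n m : ℕ) : 0 ≤ bb n m :=
  mul_nonneg (kk_nonneg m) (Finset.prod_nonneg fun i _ => trat_nonneg i m)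

lemma qnum_nonneg (n m : ℕ) : 0 ≤ qnum n m := by unfold qnum; positivity

lemma qrat_nonneg (n m : ℕ) : 0 ≤ qrat n m := by
  unfold qrat
  have := qnum_nonneg n m
  positivity

lemma comm_rat (n m : ℕ) : mrat n m * trat n (m+1) = trat n m * mrat (n+1) m := by
  unfold mrat trat
  have hn : (0:ℝ) ≤ n := n.cast_nonneg
  have hm : (0:ℝ) ≤ m := m.cast_nonneg
  rw [div_mul_div_comm, div_mul_div_comm, div_eq_div_iff (by positivity) (by positivity)]
  ring

lemma bb_m (n m : ℕ) : bb n (m+1) = bb n m * mrat n m := by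
  induction n with
  | zero => simp [bb_zero, kk, Finset.prod_range_succ]
  | succ n ih =>
    rw [bb_succ, bb_succ, ih]
    have := comm_rat n m
    push_cast
    linear_combination (bb n m) * this

lemma cert (n m : ℕ) :
    mrat n m * qrat n (m+1) - qrat n m = trat n m * rrat (n+1) m - rrat n m := by
  unfold mrat trat qrat rrat qnum
  have hn : (0:ℝ) ≤ n := n.cast_nonneg
  have hm : (0:ℝ) ≤ m := m.cast_nonneg
  generalize (n:ℝ) = x at *
  generalize (m:ℝ) = y at *
  have h1 : (y+1+x) ≠ 0 := by positivity
  have h2 : (y+2/3+2*x) ≠ 0 := by positivity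
  have h3 : (y+1/3+2*x) ≠ 0 := by positivity
  have h4 : (y+4/3+2*x) ≠ 0 := by positivity
  have h5 : (y+5/3+2*x) ≠ 0 := by positivity
  have h6 : (y+7/3+2*x) ≠ 0 := by positivity
  have h7 : (1+2*x) ≠ 0 := by positivity
  have h8 : (1+x) ≠ 0 := by positivity
  rw [show 1+y+x = y+1+x by ring, show y+1+2/3+2*x = y+5/3+2*x by ring,
    show y+1+1/3+2*x = y+4/3+2*x by ring, show y+1+4/3+2*x = y+7/3+2*x by ring,
    show y+1/3+2*(x+1) = y+7/3+2*x by ring, show 2+2*x = 2*(1+x) by ring]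
  field_simp
  ring

noncomputable def aa (n m : ℕ) : ℝ := bb n m * qrat n m
noncomputable def hh (n m : ℕ) : ℝ := bb n m * rrat n m

lemma aa_hh (n m : ℕ) : aa n (m+1) - aa n m = hh (n+1) m - hh n m := by
  unfold aa hh
  rw [bb_m, bb_succ]
  push_cast
  linear_combination (bb n m) * cert n m

lemma trat_le (n m : ℕ) : trat n m ≤ 1/16 := by
  unfold trat
  have hn : (0:ℝ) ≤ n := n.cast_nonneg
  have hm : (0:ℝ) ≤ m := m.cast_nonneg
  generalize (n:ℝ) = x at *
  generalize (m:ℝ) = y at *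
  rw [div_le_iff₀ (by positivity)]
  have e1 : (x+1/6)*(x+5/6)*4 ≤ (y+1/3+2*x)*(y+5/3+2*x) := by nlinarith [mul_nonneg hn hm]
  have e2 : (x+1/6)*(x+5/6)*4 ≤ (y+2/3+2*x)*(y+4/3+2*x) := by nlinarith [mul_nonneg hn hm]
  have e3 : (y+1/2+x)^2 ≤ (1+y+x)^2 := pow_le_pow_left₀ (by positivity) (by linarith) 2
  have e4 : (1/2+2*x)*(3/2+2*x) ≤ (1+2*x)*(2+2*x) := by nlinarith
  calc _ = 1/16*(((x+1/6)*(x+5/6)*4)*((x+1/6)*(x+5/6)*4)*(y+1/2+x)^2*((1/2+2*x)*(3/2+2*x))) := by ring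
    _ ≤ 1/16*(((y+1/3+2*x)*(y+5/3+2*x))*((y+2/3+2*x)*(y+4/3+2*x))*(1+y+x)^2*((1+2*x)*(2+2*x))) := by
      gcongr
    _ = _ := by ring

lemma trat0_le (m : ℕ) : trat 0 m ≤ 1/16*(1/(m+1)) := by
  unfold trat
  have hm : (0:ℝ) ≤ m := m.cast_nonneg
  generalize (m:ℝ) = y at *
  rw [mul_one_div, div_le_div_iff₀ (by positivity) (by positivity)]
  have e3 : (y+1/2+0)^2 ≤ (1+y+0)^2 := pow_le_pow_left₀ (by positivity) (by linarith) 2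
  have e1 : 5/9 ≤ (y+1/3)*(y+5/3) := by nlinarith
  have e2 : 8/9*(y+1) ≤ (y+2/3)*(y+4/3) := by nlinarith
  calc _ = 25/1296*(3/4)*((y+1/2+0)^2)*(y+1) := by ring
    _ ≤ 25/1296*(3/4)*((1+y+0)^2)*(y+1) := by gcongr
    _ ≤ 1/16*2*((1+y+0)^2)*(5/9*(8/9*(y+1))) := by
        have : 0 ≤ ((1+y+0)^2)*(y+1) := by positivity
        nlinarith
    _ ≤ 1/16*2*((1+y+0)^2)*((y+1/3)*(y+5/3)*((y+2/3)*(y+4/3))) := by gcongr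
    _ = _ := by ring

lemma kk_le (m : ℕ) : kk m ≤ 1/(m+1) := by
  induction m with
  | zero => simp [kk]
  | succ m ih =>
    have h : mrat 0 m ≤ (m+1)/(m+2) := by
      unfold mrat
      have hm : (0:ℝ) ≤ m := m.cast_nonneg
      generalize (m:ℝ) = y at *
      rw [div_le_div_iff₀ (by positivity) (by positivity)]
      have e1 : (y+1/6)*(y+5/6) ≤ (y+1/3)*(y+2/3) := by nlinarith
      have e2 : (y+1/2)^2*(y+2) ≤ (y+1)*(y+1)^2 := by nlinarith
      calc _ = ((y+1/6)*(y+5/6))*((y+1/2)^2*(y+2)) := by ring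
        _ ≤ ((y+1/3)*(y+2/3))*((y+1)*(y+1)^2) := by gcongr
        _ = _ := by ring
    have h0 := mrat_nonneg 0 m
    have : kk (m+1) = kk m * mrat 0 m := by simp [kk, Finset.prod_range_succ]
    rw [this]
    calc _ ≤ 1/((m:ℝ)+1) * ((m+1)/(m+2)) := by
          apply mul_le_mul ih h _ (by positivity)
          simpa using h0
      _ = _ := by
          push_cast
          field_simp
          ring

lemma bb_le (n m : ℕ) : bb n m ≤ kk m * (1/16)^n := by
  induction n with
  | zero => simp [bb_zero]
  | succ n ih =>
    rw [bb_succ, pow_succ, ← mul_assoc]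
    exact mul_le_mul ih (trat_le n m) (trat_nonneg n m) (by have := kk_nonneg m; positivity)

lemma bb_le' (n m : ℕ) : bb (n+1) m ≤ kk m * (1/16)^(n+1) * (1/(m+1)) := by
  induction n with
  | zero =>
    rw [bb_succ, bb_zero]
    have := mul_le_mul_of_nonneg_left (trat0_le m) (kk_nonneg m)
    simp only [Nat.cast_zero]
    linarith
  | succ n ih =>
    rw [bb_succ]
    have := mul_le_mul ih (trat_le (n+1) m) (trat_nonneg (n+1) m)
      (by have := kk_nonneg m; positivity)
    refine this.trans (le_of_eq ?_)
    ring

lemma qrat_le (n m : ℕ) : qrat n m ≤ 1000*((m+1)*2^n) := by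
  have h2 : (n:ℝ)+1 ≤ 2^n := by
    have := Nat.lt_two_pow_self (n := n)
    exact_mod_cast this
  have hn : (0:ℝ) ≤ n := n.cast_nonneg
  have hm : (0:ℝ) ≤ m := m.cast_nonneg
  have : qrat n m ≤ 1000*((m+1)*(n+1)) := by
    unfold qrat qnum
    generalize (n:ℝ) = x at *
    generalize (m:ℝ) = y at *
    rw [div_le_iff₀ (by positivity)]
    rw [← sub_nonneg]
    ring_nf
    positivity
  refine this.trans ?_
  gcongr

lemma aa_nonneg (n m : ℕ) : 0 ≤ aa n m := mul_nonneg (bb_nonneg n m) (qrat_nonneg n m)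

lemma aa_le (n m : ℕ) : aa n m ≤ 1000*(1/8)^n := by
  have h := mul_le_mul ((bb_le n m).trans (mul_le_mul_of_nonneg_right (kk_le m) (by positivity)))
    (qrat_le n m) (qrat_nonneg n m) (by positivity)
  refine h.trans (le_of_eq ?_)
  have hm : (m:ℝ)+1 ≠ 0 := by positivity
  rw [show (1/8:ℝ) = (1/16)*2 by norm_num, mul_pow]
  field_simp

lemma aa_le' (n m : ℕ) : aa (n+1) m ≤ 1000*(1/8)^(n+1) * (1/(m+1)) := by
  have h := mul_le_mul ((bb_le' n m).trans (mul_le_mul_of_nonneg_right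
    (mul_le_mul_of_nonneg_right (kk_le m) (by positivity)) (by positivity)))
    (qrat_le (n+1) m) (qrat_nonneg (n+1) m) (by positivity)
  refine h.trans (le_of_eq ?_)
  have hm : (m:ℝ)+1 ≠ 0 := by positivity
  rw [show (1/8:ℝ) = (1/16)*2 by norm_num, mul_pow]
  field_simp

lemma hh_le (n m : ℕ) : hh n m ≤ 4*(n*(1/16)^n) := by
  have hn : (0:ℝ) ≤ n := n.cast_nonneg
  have hm : (0:ℝ) ≤ m := m.cast_nonneg
  have hr : rrat n m ≤ 4*n := by
    unfold rrat
    rw [div_le_iff₀ (by positivity)]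
    nlinarith
  have hr0 : 0 ≤ rrat n m := by unfold rrat; positivity
  have hk : kk m ≤ 1 := (kk_le m).trans (by
    rw [div_le_one (by positivity)]; linarith)
  have h := mul_le_mul ((bb_le n m).trans (mul_le_mul_of_nonneg_right hk (by positivity)))
    hr hr0 (by positivity)
  refine h.trans (le_of_eq ?_)
  ring

lemma hh_nonneg (n m : ℕ) : 0 ≤ hh n m := by
  have := bb_nonneg n m
  unfold hh rrat
  positivity

lemma geo_summable : Summable (fun n : ℕ => (1000:ℝ)*(1/8)^n) :=
  (summable_geometric_of_lt_one (by norm_num) (by norm_num)).mul_left _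

lemma aa_summable (m : ℕ) : Summable (fun n => aa n m) :=
  Summable.of_nonneg_of_le (fun n => aa_nonneg n m) (fun n => aa_le n m) geo_summable

lemma hh_tendsto (m : ℕ) : Filter.Tendsto (fun n => hh n m) Filter.atTop (nhds 0) := by
  have h : Filter.Tendsto (fun n : ℕ => 4*((n:ℝ)*(1/16)^n)) Filter.atTop (nhds 0) := by
    have := (tendsto_self_mul_const_pow_of_lt_one (r := (1/16:ℝ)) (by norm_num) (by norm_num)).const_mul 4
    simpa using this
  exact squeeze_zero (fun n => hh_nonneg n m) (fun n => hh_le n m) h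

lemma sum_const (m : ℕ) : ∑' n, aa n (m+1) = ∑' n, aa n m := by
  have h1 := ((aa_summable (m+1)).hasSum.sub (aa_summable m).hasSum).tendsto_sum_nat
  have h2 : ∀ N, ∑ i ∈ Finset.range N, (aa i (m+1) - aa i m) = hh N m := by
    intro N
    simp only [aa_hh]
    rw [Finset.sum_range_sub (fun n => hh n m)]
    simp [hh, rrat]
  simp only [h2] at h1
  have := tendsto_nhds_unique h1 (hh_tendsto m)
  linarith

lemma sum_const' (m : ℕ) : ∑' n, aa n m = ∑' n, aa n 0 := by
  induction m with
  | zero => rfl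
  | succ m ih => rw [sum_const, ih]

lemma kk_closed (m : ℕ) : kk m * (∏ j ∈ Finset.range m, (1 - (1/3:ℝ)^2/((j:ℝ)+1)^2)) =
    (∏ j ∈ Finset.range m, (1 - (1/6:ℝ)^2/((j:ℝ)+1)^2)) *
    (∏ j ∈ Finset.range m, (1 - (1/2:ℝ)^2/((j:ℝ)+1)^2)) *
    (1/4*(m+1/3)/((m+1/6)*(m+1/2))) := by
  induction m with
  | zero => norm_num [kk]
  | succ m ih =>
    have hk : kk (m+1) = kk m * mrat 0 m := by simp [kk, Finset.prod_range_succ]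
    rw [hk, Finset.prod_range_succ, Finset.prod_range_succ, Finset.prod_range_succ]
    rw [show ∀ a b c d : ℝ, a*b*(c*d) = (a*c)*(b*d) by intros; ring, ih]
    generalize (∏ j ∈ Finset.range m, (1 - (1/6:ℝ)^2/((j:ℝ)+1)^2)) = X
    generalize (∏ j ∈ Finset.range m, (1 - (1/2:ℝ)^2/((j:ℝ)+1)^2)) = Y
    have hm : (0:ℝ) ≤ m := m.cast_nonneg
    push_cast
    unfold mrat
    generalize (m:ℝ) = y at *
    have h1 : (y+1) ≠ 0 := by positivity
    have h2 : (y+1/6) ≠ 0 := by positivity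
    have h3 : (y+1/2) ≠ 0 := by positivity
    have h4 : (y+1/3) ≠ 0 := by positivity
    have h5 : (y+2/3) ≠ 0 := by positivity
    have h6 : (y+7/6) ≠ 0 := by positivity
    have h7 : (y+3/2) ≠ 0 := by positivity
    have e (x : ℝ) : 1 - x^2/(y+1)^2 = (y+1-x)*(y+1+x)/(y+1)^2 := by
      field_simp
      ring
    rw [e, e, e, show y+1+1/6 = y+7/6 by ring, show y+1+1/2 = y+3/2 by ring,
      show y+1/2+0 = y+1/2 by ring, show y+1+0 = y+1 by ring, show y+2/3+2*0 = y+2/3 by ring,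
      show y+1/3+2*0 = y+1/3 by ring, show y+1-1/3 = y+2/3 by ring,
      show y+1-1/6 = y+5/6 by ring, show y+1-1/2 = y+1/2 by ring]
    have hX : (1/4*(y+1/3)/((y+1/6)*(y+1/2)) * ((y+1/2)^2*(y+1/6)*(y+5/6)/((y+1)^2*(y+2/3)*(y+1/3))
        * ((y+2/3)*(y+1+1/3)/(y+1)^2))) = ((y+5/6)*(y+7/6)/(y+1)^2)*((y+1/2)*(y+3/2)/(y+1)^2) *
        (1/4*(y+1+1/3)/((y+7/6)*(y+3/2))) := by
      field_simp
    linear_combination (X*Y)*hX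

lemma euler_lim (x : ℝ) (hx : x ≠ 0) :
    Filter.Tendsto (fun n : ℕ => ∏ j ∈ Finset.range n, (1 - x^2/((j:ℝ)+1)^2)) Filter.atTop
      (nhds (Real.sin (π*x)/(π*x))) := by
  have h := (Real.tendsto_euler_sin_prod x).div_const (π*x)
  have hp : π*x ≠ 0 := mul_ne_zero Real.pi_ne_zero hx
  refine h.congr fun n => ?_
  field_simp

lemma rat_lim : Filter.Tendsto (fun m : ℕ => (1/4*((m:ℝ)+1/3)/((m+1/6)*(m+1/2))) * qrat 0 m)
    Filter.atTop (nhds (1/4)) := by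
  have hi : Filter.Tendsto (fun m : ℕ => ((m:ℝ))⁻¹) Filter.atTop (nhds 0) :=
    tendsto_inv_atTop_zero.comp tendsto_natCast_atTop_atTop
  have hc : Filter.Tendsto (fun u : ℝ => (1/4*(1+1/3*u)/((1+1/6*u)*(1+1/2*u))) *
      ((5/96*u^4+7/12*u^3+47/24*u^2+5/2*u+1)/((1+2/3*u)*(1+1/3*u)*(1+4/3*u)))) (nhds 0)
      (nhds (1/4)) := by
    have : ContinuousAt (fun u : ℝ => (1/4*(1+1/3*u)/((1+1/6*u)*(1+1/2*u))) *
      ((5/96*u^4+7/12*u^3+47/24*u^2+5/2*u+1)/((1+2/3*u)*(1+1/3*u)*(1+4/3*u)))) 0 := by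
      refine ContinuousAt.mul (ContinuousAt.div (by fun_prop) (by fun_prop) (by norm_num))
        (ContinuousAt.div (by fun_prop) (by fun_prop) (by norm_num))
    have h2 := this.tendsto
    norm_num at h2 ⊢
    exact h2
  refine (hc.comp hi).congr' ?_
  filter_upwards [Filter.eventually_gt_atTop 0] with m hm
  have hm' : (0:ℝ) < m := by exact_mod_cast hm
  simp only [Function.comp, qrat, qnum]
  generalize (m:ℝ) = y at *
  have h2 : (y+1/6) ≠ 0 := by positivity
  have h3 : (y+1/2) ≠ 0 := by positivity
  have h4 : (y+1/3) ≠ 0 := by positivity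
  have h5 : (y+2/3) ≠ 0 := by positivity
  have h6 : (y+4/3) ≠ 0 := by positivity
  have g (c : ℝ) : 1 + c*y⁻¹ = (y+c)/y := by field_simp
  rw [g, g, g, g, g, show y+2/3+2*0 = y+2/3 by ring,
      show y+1/3+2*0 = y+1/3 by ring, show y+4/3+2*0 = y+4/3 by ring]
  field_simp
  ring

lemma aa0_lim : Filter.Tendsto (fun m => aa 0 m) Filter.atTop (nhds (1/(π*Real.sqrt 3))) := by
  have h3 := euler_lim (1/3) (by norm_num)
  have h6 := euler_lim (1/6) (by norm_num)
  have h2 := euler_lim (1/2) (by norm_num)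
  rw [show π*(1/3) = π/3 by ring, Real.sin_pi_div_three] at h3
  rw [show π*(1/6) = π/6 by ring, Real.sin_pi_div_six] at h6
  rw [show π*(1/2) = π/2 by ring, Real.sin_pi_div_two] at h2
  have hpi := Real.pi_pos
  have hs : 0 < Real.sqrt 3 := by positivity
  have h := ((h6.mul h2).div h3 (by positivity)).mul rat_lim
  have hv : (1/2/(π/6)*(1/(π/2))/(Real.sqrt 3/2/(π/3))*(1/4)) = 1/(π*Real.sqrt 3) := by
    field_simp
    norm_num
  rw [hv] at h
  refine h.congr fun m => ?_
  have hne : (∏ j ∈ Finset.range m, (1 - (1/3:ℝ)^2/((j:ℝ)+1)^2)) ≠ 0 := by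
    rw [Finset.prod_ne_zero_iff]
    intro j _
    have : (1/3:ℝ)^2/((j:ℝ)+1)^2 < 1 := by
      rw [div_lt_one (by positivity)]
      have : (0:ℝ) ≤ j := j.cast_nonneg
      nlinarith
    linarith
  have hk := kk_closed m
  simp only [aa, bb_zero, Pi.div_apply, Nat.cast_zero]
  rw [← eq_div_iff hne] at hk
  rw [hk]
  ring

lemma sum_zero : ∑' n, aa n 0 = 1/(π*Real.sqrt 3) := by
  have h : Filter.Tendsto (fun m => ∑' n, aa n m) Filter.atTop
      (nhds (∑' n : ℕ, if n = 0 then 1/(π*Real.sqrt 3) else 0)) := by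
    refine tendsto_tsum_of_dominated_convergence geo_summable ?_ ?_
    · intro n
      rcases n with _ | n
      · simpa using aa0_lim
      · have h1 : Filter.Tendsto (fun m : ℕ => 1000*(1/8:ℝ)^(n+1) * (1/((m:ℝ)+1)))
            Filter.atTop (nhds 0) := by
          have := (tendsto_one_div_add_atTop_nhds_zero_nat (𝕜 := ℝ)).const_mul (1000*(1/8:ℝ)^(n+1))
          simpa using this
        have := squeeze_zero (fun m => aa_nonneg (n+1) m) (fun m => aa_le' n m) h1
        simpa using this
    · refine Filter.Eventually.of_forall fun m n => ?_
      rw [Real.norm_of_nonneg (aa_nonneg n m)]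
      exact aa_le n m
  rw [tsum_ite_eq] at h
  simp only [sum_const'] at h
  exact tendsto_nhds_unique tendsto_const_nhds h

lemma poch_succ (x : ℝ) (n : ℕ) : poch x (n+1) = poch x n * (x+n) := by
  simp [poch, Finset.prod_range_succ]

lemma poch_pos (x : ℝ) (hx : 0 < x) (n : ℕ) : 0 < poch x n :=
  Finset.prod_pos fun i _ => by positivity

lemma bb_poch (n : ℕ) : bb n 0 = (1 / 16 ^ n) *
      (poch (1/2) n * poch (1/4) n * poch (3/4) n * poch (1/6) n * poch (5/6) n /
        (poch 1 n ^ 3 * poch (4/3) n * poch (5/3) n)) * ((1+3*n)*(2+3*n)/2) := by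
  induction n with
  | zero => simp [bb_zero, kk, poch]
  | succ n ih =>
    rw [bb_succ, ih]
    simp only [poch_succ]
    have p1 := (poch_pos 1 (by norm_num) n).ne'
    have p2 := (poch_pos (4/3) (by norm_num) n).ne'
    have p3 := (poch_pos (5/3) (by norm_num) n).ne'
    generalize poch 1 n = a1 at *
    generalize poch (4/3) n = a2 at *
    generalize poch (5/3) n = a3 at *
    generalize poch (1/2) n = b1
    generalize poch (1/4) n = b2
    generalize poch (3/4) n = b3
    generalize poch (1/6) n = b4
    generalize poch (5/6) n = b5
    have hn : (0:ℝ) ≤ n := n.cast_nonneg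
    have key : (1+3*(n:ℝ))*(2+3*n)/2 * trat n (0:ℕ) = 1/16 * ((1/2+n)*(1/4+n)*(3/4+n)*(1/6+n)*(5/6+n)
        /((1+n)^3*(4/3+n)*(5/3+n))) * ((1+3*(n+1))*(2+3*(n+1))/2) := by
      unfold trat
      push_cast
      generalize (n:ℝ) = x at *
      rw [mul_div_assoc', mul_div_assoc' (1/16:ℝ), div_mul_eq_mul_div,
        div_mul_eq_mul_div, div_eq_div_iff (by positivity) (by positivity)]
      ring
    rw [mul_assoc, key]
    push_cast
    generalize (n:ℝ) = x at *
    generalize ((1+3*(x+1))*(2+3*(x+1))/2) = V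
    have h1 : 1+x ≠ 0 := by positivity
    have h2 : 4/3+x ≠ 0 := by positivity
    have h3 : 5/3+x ≠ 0 := by positivity
    field_simp
    ring

theorem series_256_div_3pi_sqrt3 :
    (256 : ℝ) / (3 * π * Real.sqrt 3) = ∑' n : ℕ, (1 / 16 ^ n) *
      (poch (1/2) n * poch (1/4) n * poch (3/4) n * poch (1/6) n * poch (5/6) n /
        (poch 1 n ^ 3 * poch (4/3) n * poch (5/3) n)) *
      (720 * (n : ℝ) ^ 3 + 804 * (n : ℝ) ^ 2 + 236 * n + 15) := by
  have h : ∀ n : ℕ, (1 / 16 ^ n) *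
      (poch (1/2) n * poch (1/4) n * poch (3/4) n * poch (1/6) n * poch (5/6) n /
        (poch 1 n ^ 3 * poch (4/3) n * poch (5/3) n)) *
      (720 * (n : ℝ) ^ 3 + 804 * (n : ℝ) ^ 2 + 236 * n + 15) = 256/3 * aa n 0 := by
    intro n
    rw [aa, bb_poch]
    generalize (1 / 16 ^ n) *
      (poch (1/2) n * poch (1/4) n * poch (3/4) n * poch (1/6) n * poch (5/6) n /
        (poch 1 n ^ 3 * poch (4/3) n * poch (5/3) n)) = Z
    have key : (720 * (n : ℝ) ^ 3 + 804 * (n : ℝ) ^ 2 + 236 * n + 15) =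
        256/3 * (((1+3*n)*(2+3*n)/2) * qrat n (0:ℕ)) := by
      unfold qrat qnum
      have hn : (0:ℝ) ≤ n := n.cast_nonneg
      rw [mul_div_assoc', mul_div_assoc', eq_div_iff (by positivity)]
      push_cast
      ring
    rw [key]
    ring
  simp only [h]
  rw [tsum_mul_left, sum_zero]
  have hpi := Real.pi_pos
  have hs : 0 < Real.sqrt 3 := by positivity
  field_simp
end

section
/- 48·π·Γ(2/3)²/Γ(1/6)² = ∑_{n=0}^∞ (−1/27)^n · [(1)_n (1/2)_n (1/3)_n / ((5/3)_n³)] · (9 + 28n + 21n²). -/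
open Real

open Filter Topology

namespace Aux48

/-- `(1/3)_k / (5/3)_k / (2k+1)`, the Dixon summand. -/
noncomputable def f0 (k : ℕ) : ℝ :=
  (∏ j ∈ Finset.range k, (((j : ℝ) + 1/3) / (j + 5/3))) / (2 * k + 1)

noncomputable def rr (n k : ℕ) : ℝ :=
  -((n + k + 1/3 : ℝ) * (2 * k + n + 1) * (n + 1/2) * (n + 4/3) * (n + 1)) /
    ((n + k + 5/3) * (2 * k + 3 * n + 2) * (2 * k + 3 * n + 3) * (2 * k + 3 * n + 4) * (n + 2/3))

noncomputable def FF (n k : ℕ) : ℝ := (∏ i ∈ Finset.range n, rr i k) * f0 k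

noncomputable def GG (n k : ℕ) : ℝ :=
  FF n k * ((9 + 28 * n + 21 * n ^ 2 + 13 * k + 21 * n * k + 6 * k ^ 2 : ℝ) /
    (2 * (3 * n + 2) * (2 * k + 3 * n + 2)))

lemma f0_succ (k : ℕ) : f0 (k + 1) =
    f0 k * ((k + 1/3 : ℝ) * (2 * k + 1) / ((k + 5/3) * (2 * k + 3))) := by
  unfold f0
  rw [Finset.prod_range_succ]
  push_cast
  field_simp
  ring

lemma f0_pos (k : ℕ) : 0 < f0 k := by
  unfold f0; positivity

lemma f0_le (k : ℕ) : f0 k ≤ 1 / (((k : ℝ) + 1) * (2 * k + 1)) := by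
  induction k with
  | zero => simp [f0]
  | succ k ih =>
    rw [f0_succ]
    calc _ ≤ 1 / (((k : ℝ) + 1) * (2 * k + 1)) *
          ((k + 1/3 : ℝ) * (2 * k + 1) / ((k + 5/3) * (2 * k + 3))) := by gcongr
      _ ≤ _ := by
        push_cast
        rw [div_mul_div_comm, div_le_div_iff₀ (by positivity) (by positivity)]
        have hk : (0:ℝ) ≤ k := by positivity
        rw [← sub_nonneg]
        ring_nf
        positivity

lemma FF_succ (n k : ℕ) : FF (n + 1) k = FF n k * rr n k := by
  unfold FF; rw [Finset.prod_range_succ]; ring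

lemma FF_succ_k (n k : ℕ) : FF n (k + 1) = FF n k *
    ((n + k + 1/3 : ℝ) * (2 * k + n + 1) * (2 * k + n + 2) /
      ((n + k + 5/3) * (2 * k + 3 * n + 2) * (2 * k + 3 * n + 3))) := by
  induction n with
  | zero =>
    simp only [FF, Finset.range_zero, Finset.prod_empty, one_mul, f0_succ]
    push_cast
    field_simp
    ring
  | succ n ih =>
    rw [FF_succ, FF_succ, ih]
    unfold rr
    push_cast
    field_simp
    ring

lemma wz (n k : ℕ) : FF (n + 1) k - FF n k = GG n (k + 1) - GG n k := by
  unfold GG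
  rw [FF_succ, FF_succ_k]
  unfold rr
  push_cast
  field_simp
  ring

lemma rr_abs (n k : ℕ) : |rr n k| ≤ 1/9 := by
  unfold rr
  rw [neg_div, abs_neg, abs_of_nonneg (by positivity), div_le_div_iff₀ (by positivity) (by positivity),
    ← sub_nonneg]
  ring_nf
  positivity

lemma FF_abs (n k : ℕ) : |FF n k| ≤ (1/9) ^ n * f0 k := by
  induction n with
  | zero => simp [FF, abs_of_pos (f0_pos k)]
  | succ n ih =>
    rw [FF_succ, abs_mul, pow_succ]
    calc _ ≤ ((1/9) ^ n * f0 k) * (1/9) := by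
          have := f0_pos k
          exact mul_le_mul ih (rr_abs n k) (abs_nonneg _) (by positivity)
      _ = _ := by ring

lemma GG_abs (n k : ℕ) : |GG n k| ≤ (1/9 : ℝ) ^ n * (4 / (k + 1)) := by
  unfold GG
  rw [abs_mul]
  have h1 : |(9 + 28 * n + 21 * n ^ 2 + 13 * k + 21 * n * k + 6 * k ^ 2 : ℝ) /
    (2 * (3 * n + 2) * (2 * k + 3 * n + 2))| ≤ 4 * (2 * k + 1) := by
    rw [abs_of_nonneg (by positivity), div_le_iff₀ (by positivity), ← sub_nonneg]
    ring_nf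
    positivity
  calc _ ≤ ((1/9 : ℝ) ^ n * (1 / (((k : ℝ) + 1) * (2 * k + 1)))) * (4 * (2 * k + 1)) := by
        gcongr
        exact (FF_abs n k).trans (by gcongr; exact f0_le k)
    _ = _ := by field_simp

lemma geo : Summable (fun n : ℕ => (1/9 : ℝ) ^ n) :=
  summable_geometric_of_lt_one (by norm_num) (by norm_num)

lemma GG_summable (k : ℕ) : Summable (fun n => GG n k) :=
  Summable.of_norm_bounded (geo.mul_right (4 / ((k : ℝ) + 1))) (fun n => GG_abs n k)

lemma tend_inv : Tendsto (fun k : ℕ => 1 / ((k : ℝ) + 1)) atTop (𝓝 0) :=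
  tendsto_one_div_add_atTop_nhds_zero_nat

lemma S_tend : Tendsto (fun k => ∑' n, GG n k) atTop (𝓝 0) := by
  have h : ∀ k : ℕ, ‖∑' n, GG n k‖ ≤ (∑' n : ℕ, (1/9 : ℝ) ^ n) * 4 * (1 / ((k : ℝ) + 1)) := by
    intro k
    have := tsum_of_norm_bounded (f := fun n => GG n k)
      (geo.mul_right (4 / ((k : ℝ) + 1))).hasSum (fun n => GG_abs n k)
    rw [tsum_mul_right] at this
    calc _ ≤ _ := this
      _ = _ := by ring
  refine squeeze_zero_norm h ?_
  simpa using tend_inv.const_mul ((∑' n : ℕ, (1/9 : ℝ) ^ n) * 4)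

lemma FF_tend (k : ℕ) : Tendsto (fun n => FF n k) atTop (𝓝 0) := by
  refine squeeze_zero_norm (fun n => FF_abs n k) ?_
  simpa using (geo.tendsto_atTop_zero).mul_const (f0 k)

lemma S_step (k : ℕ) : (∑' n, GG n k) - ∑' n, GG n (k + 1) = f0 k := by
  rw [← (GG_summable k).tsum_sub (GG_summable (k + 1))]
  have hs := (GG_summable k).sub (GG_summable (k + 1))
  have h1 := hs.hasSum.tendsto_sum_nat
  refine tendsto_nhds_unique h1 ?_
  have h2 : ∀ N, ∑ n ∈ Finset.range N, (GG n k - GG n (k + 1)) = f0 k - FF N k := by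
    intro N
    have : ∀ n, GG n k - GG n (k + 1) = FF n k - FF (n + 1) k := fun n => by
      linarith [wz n k]
    simp only [this]
    rw [Finset.sum_range_sub']
    simp [FF]
  simp only [h2]
  simpa using (FF_tend k).const_sub (f0 k)

lemma S_eq : Tendsto (fun K => ∑ k ∈ Finset.range K, f0 k) atTop (𝓝 (∑' n, GG n 0)) := by
  have h2 : ∀ K, ∑ k ∈ Finset.range K, f0 k = (∑' n, GG n 0) - ∑' n, GG n K := by
    intro K
    rw [← Finset.sum_range_sub' (fun k => ∑' n, GG n k)]
    exact Finset.sum_congr rfl (fun k _ => (S_step k).symm)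
  simp only [h2]
  simpa using S_tend.const_sub (∑' n, GG n 0)

/-! Step 2: the Dougall / Dixon evaluation. -/

noncomputable def ra (a : ℝ) (j : ℕ) : ℝ :=
  (a + 2 * j + 2) * (a + j) * (j + 1/3) * (j + 1/2) ^ 2 /
    ((a + 2 * j) * (j + 1) * (a + 1/2 + j) ^ 2 * (a + 2/3 + j))

noncomputable def T (a : ℝ) (k : ℕ) : ℝ := ∏ j ∈ Finset.range k, ra a j

lemma T_succ (a : ℝ) (k : ℕ) : T a (k + 1) = T a k * ra a k := Finset.prod_range_succ _ _

lemma T_one (k : ℕ) : T 1 k = f0 k := by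
  induction k with
  | zero => simp [T, f0]
  | succ k ih =>
    rw [T_succ, f0_succ, ih, ra]
    field_simp
    ring

lemma T_pos (a : ℝ) (ha : 1 ≤ a) (k : ℕ) : 0 < T a k := by
  have : 0 < a := by linarith
  unfold T ra; positivity

lemma T_shift (a : ℝ) (ha : 1 ≤ a) (k : ℕ) : T (a + 1) k = T a k *
    ((a + 1 + 2 * k) * (a + k) * (a + 1/2) ^ 2 * (a + 2/3) /
      ((a + 2 * k) * (a + 1) * (a + 1/2 + k) ^ 2 * (a + 2/3 + k))) := by
  have : 0 < a := by linarith
  induction k with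
  | zero => simp [T]; field_simp
  | succ k ih =>
    rw [T_succ, T_succ, ih]
    unfold ra
    push_cast
    have e1 : a + 1 + 2 * (k : ℝ) ≠ 0 := by positivity
    have e2 : a + 1 + 1/2 + (k : ℝ) ≠ 0 := by positivity
    have e3 : a + 1 + 2/3 + (k : ℝ) ≠ 0 := by positivity
    field_simp
    ring

noncomputable def rho (a : ℝ) : ℝ :=
  (a + 1) * a * (a + 1/6) ^ 2 / ((a + 1/2) ^ 2 * (a + 2/3) * (a - 1/3))

noncomputable def Gc (a : ℝ) (k : ℕ) : ℝ :=
  T a k * (k * (k + 2 * a - 1/3) / ((a + 2 * k) * (a - 1/3)))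

lemma wz2 (a : ℝ) (ha : 1 ≤ a) (k : ℕ) : T a k - rho a * T (a + 1) k = Gc a k - Gc a (k + 1) := by
  have : 0 < a := by linarith
  have h3 : 0 < a - 1/3 := by linarith
  rw [T_shift a ha]
  unfold Gc
  rw [T_succ]
  unfold ra rho
  push_cast
  obtain ⟨b, hb⟩ : ∃ b, b = a - 1/3 := ⟨_, rfl⟩
  rw [← hb] at h3 ⊢
  have hab : a = b + 1/3 := by linarith
  field_simp
  rw [hab]
  ring

lemma T_le (a : ℝ) (ha : 1 ≤ a) (k : ℕ) :
    T a (k + 1) ≤ 1 / a * (1 / (((k : ℝ) + 1) * (k + 2))) := by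
  obtain ⟨x, hx, rfl⟩ : ∃ x : ℝ, 0 ≤ x ∧ a = 1 + x := ⟨a - 1, by linarith, by ring⟩
  induction k with
  | zero =>
    simp only [T, ra, zero_add, Finset.prod_range_one]
    rw [div_mul_div_comm, div_le_div_iff₀ (by positivity) (by positivity), ← sub_nonneg]
    push_cast
    ring_nf
    positivity
  | succ k ih =>
    rw [T_succ]
    have hr : ra (1 + x) (k + 1) ≤ ((k : ℝ) + 1) / (k + 3) := by
      unfold ra
      rw [div_le_div_iff₀ (by positivity) (by positivity), ← sub_nonneg]
      push_cast
      ring_nf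
      positivity
    have hr0 : 0 ≤ ra (1 + x) (k + 1) := by unfold ra; positivity
    calc _ ≤ (1 / (1 + x) * (1 / (((k : ℝ) + 1) * (k + 2)))) * (((k : ℝ) + 1) / (k + 3)) := by
          gcongr
      _ = _ := by push_cast; field_simp; ring

lemma tele : HasSum (fun k : ℕ => 1 / (((k : ℝ) + 1) * (k + 2))) 1 := by
  rw [hasSum_iff_tendsto_nat_of_nonneg (fun k => by positivity)]
  have h : ∀ N : ℕ, ∑ k ∈ Finset.range N, 1 / (((k : ℝ) + 1) * (k + 2)) = 1 - 1 / ((N : ℝ) + 1) := by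
    intro N
    induction N with
    | zero => simp
    | succ n ih => rw [Finset.sum_range_succ, ih]; push_cast; field_simp; ring
  simp only [h]
  simpa using tend_inv.const_sub 1

lemma T_summable' (a : ℝ) (ha : 1 ≤ a) : Summable (fun k => T a (k + 1)) :=
  Summable.of_nonneg_of_le (fun k => (T_pos a ha _).le) (T_le a ha) (tele.summable.mul_left _)

lemma T_summable (a : ℝ) (ha : 1 ≤ a) : Summable (T a) :=
  (summable_nat_add_iff 1).1 (T_summable' a ha)

lemma W_bound (a : ℝ) (ha : 1 ≤ a) : ‖(∑' k, T a k) - 1‖ ≤ 1 / a := by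
  rw [(T_summable a ha).tsum_eq_zero_add]
  have h0 : T a 0 = 1 := by simp [T]
  rw [h0, add_sub_cancel_left, Real.norm_eq_abs,
    abs_of_nonneg (tsum_nonneg (fun k => (T_pos a ha _).le))]
  have := (T_summable' a ha).tsum_le_tsum (T_le a ha) (tele.summable.mul_left _)
  rwa [tsum_mul_left, tele.tsum_eq, mul_one] at this

lemma Gc_tend (a : ℝ) (ha : 1 ≤ a) : Tendsto (fun k => Gc a k) atTop (𝓝 0) := by
  rw [← tendsto_add_atTop_iff_nat 1]
  have h0 : 0 < a := by linarith
  have h3 : 0 < a - 1/3 := by linarith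
  have hb : ∀ k : ℕ, ‖Gc a (k + 1)‖ ≤ (1 / a * 2 / (a - 1/3)) * (1 / ((k : ℝ) + 1)) := by
    intro k
    have hn : 0 ≤ (((k + 1 : ℕ) : ℝ)) + 2 * a - 1/3 := by push_cast; linarith [Nat.cast_nonneg (α := ℝ) k]
    have hT := T_pos a ha (k + 1)
    unfold Gc
    rw [Real.norm_eq_abs, abs_of_nonneg (by positivity)]
    have hR : (((k + 1 : ℕ) : ℝ) * (((k + 1 : ℕ) : ℝ) + 2 * a - 1/3) /
        ((a + 2 * ((k + 1 : ℕ) : ℝ)) * (a - 1/3))) ≤ 2 * (k + 2) / (a - 1/3) := by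
      rw [div_le_div_iff₀ (by positivity) h3]
      push_cast
      have hk : (0:ℝ) ≤ k := by positivity
      have : ((k:ℝ) + 1) * (k + 1 + 2 * a - 1/3) ≤ 2 * (k + 2) * (a + 2 * (k + 1)) := by nlinarith
      nlinarith
    calc _ ≤ (1 / a * (1 / (((k : ℝ) + 1) * (k + 2)))) * (2 * (k + 2) / (a - 1/3)) := by
          gcongr
          exact T_le a ha k
      _ = _ := by field_simp
  refine squeeze_zero_norm hb ?_
  simpa using tend_inv.const_mul (1 / a * 2 / (a - 1/3))

lemma W_step (a : ℝ) (ha : 1 ≤ a) : ∑' k, T a k = rho a * ∑' k, T (a + 1) k := by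
  have s1 := T_summable a ha
  have s2 := (T_summable (a + 1) (by linarith)).mul_left (rho a)
  rw [← tsum_mul_left, ← sub_eq_zero, ← s1.tsum_sub s2]
  refine tendsto_nhds_unique (s1.sub s2).hasSum.tendsto_sum_nat ?_
  simp only [wz2 a ha]
  simp only [Finset.sum_range_sub']
  have : Gc a 0 = 0 := by simp [Gc]
  rw [this]
  simpa using (Gc_tend a ha).const_sub 0

lemma W_iter (m : ℕ) : ∑' k, T 1 k =
    (∏ j ∈ Finset.range m, rho (1 + j)) * ∑' k, T (1 + m) k := by
  induction m with
  | zero => simp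
  | succ m ih =>
    rw [ih, Finset.prod_range_succ, W_step (1 + m) (by linarith [Nat.cast_nonneg (α := ℝ) m])]
    push_cast
    rw [add_assoc (1:ℝ) m 1]
    ring

lemma W_tend : Tendsto (fun m : ℕ => ∑' k, T (1 + m) k) atTop (𝓝 1) := by
  rw [tendsto_iff_norm_sub_tendsto_zero]
  refine squeeze_zero (fun _ => norm_nonneg _)
    (fun m => W_bound (1 + m) (by linarith [Nat.cast_nonneg (α := ℝ) m])) ?_
  simpa [add_comm] using tend_inv

lemma gs (x : ℝ) (n : ℕ) : Real.GammaSeq x n =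
    (n : ℝ) ^ x * (n.factorial : ℝ) / ∏ j ∈ Finset.range (n + 1), (x + j) := rfl

lemma prod_rho (n : ℕ) (hn : 0 < n) : ∏ j ∈ Finset.range (n + 1), rho (1 + j) =
    Real.GammaSeq (3/2) n ^ 2 * Real.GammaSeq (5/3) n * Real.GammaSeq (2/3) n /
      (Real.GammaSeq 2 n * Real.GammaSeq 1 n * Real.GammaSeq (7/6) n ^ 2) := by
  have hn' : (0:ℝ) < n := by exact_mod_cast hn
  have hp : ∀ x : ℝ, 0 < x → 0 < ∏ j ∈ Finset.range (n + 1), (x + j) :=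
    fun x hx => Finset.prod_pos (fun j _ => by positivity)
  have e : ∀ j : ℕ, rho (1 + j) = (2 + (j:ℝ)) * (1 + j) * (7/6 + j) ^ 2 /
      ((3/2 + (j:ℝ)) ^ 2 * (5/3 + j) * (2/3 + j)) := by
    intro j; unfold rho; congr 1 <;> ring
  simp only [e, Finset.prod_div_distrib, Finset.prod_mul_distrib, Finset.prod_pow, gs]
  have p1 := hp 2 (by norm_num)
  have p2 := hp 1 (by norm_num)
  have p3 := hp (7/6) (by norm_num)
  have p4 := hp (3/2) (by norm_num)
  have p5 := hp (5/3) (by norm_num)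
  have p6 := hp (2/3) (by norm_num)
  have hpow : ((n:ℝ) ^ (3/2:ℝ)) ^ 2 * (n:ℝ) ^ (5/3:ℝ) * (n:ℝ) ^ (2/3:ℝ) =
      (n:ℝ) ^ (2:ℝ) * (n:ℝ) ^ (1:ℝ) * ((n:ℝ) ^ (7/6:ℝ)) ^ 2 := by
    simp only [← Real.rpow_natCast, ← Real.rpow_mul hn'.le, ← Real.rpow_add hn']
    norm_num
  have q1 : 0 < (n:ℝ) ^ (2:ℝ) := Real.rpow_pos_of_pos hn' _
  have q2 : 0 < (n:ℝ) ^ (1:ℝ) := Real.rpow_pos_of_pos hn' _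
  have q3 : 0 < (n:ℝ) ^ (7/6:ℝ) := Real.rpow_pos_of_pos hn' _
  have hf : (0:ℝ) < n.factorial := by exact_mod_cast n.factorial_pos
  generalize (n:ℝ) ^ (2:ℝ) = A at *
  generalize (n:ℝ) ^ (1:ℝ) = B at *
  generalize (n:ℝ) ^ (7/6:ℝ) = C at *
  generalize (n:ℝ) ^ (3/2:ℝ) = D at *
  generalize (n:ℝ) ^ (5/3:ℝ) = E at *
  generalize (n:ℝ) ^ (2/3:ℝ) = H at *
  generalize (n.factorial:ℝ) = fa at *
  generalize (∏ j ∈ Finset.range (n + 1), ((2:ℝ) + j)) = P1 at *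
  generalize (∏ j ∈ Finset.range (n + 1), ((1:ℝ) + j)) = P2 at *
  generalize (∏ j ∈ Finset.range (n + 1), ((7/6:ℝ) + j)) = P3 at *
  generalize (∏ j ∈ Finset.range (n + 1), ((3/2:ℝ) + j)) = P4 at *
  generalize (∏ j ∈ Finset.range (n + 1), ((5/3:ℝ) + j)) = P5 at *
  generalize (∏ j ∈ Finset.range (n + 1), ((2/3:ℝ) + j)) = P6 at *
  field_simp
  linarith [hpow]

lemma dixon : ∑' k, f0 k = 6 * π * Real.Gamma (2/3) ^ 2 / Real.Gamma (1/6) ^ 2 := by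
  have h1 : ∑' k, f0 k = ∑' k, T 1 k := tsum_congr (fun k => (T_one k).symm)
  rw [h1]
  have g : ∀ x : ℝ, Tendsto (Real.GammaSeq x) atTop (𝓝 (Real.Gamma x)) :=
    Real.GammaSeq_tendsto_Gamma
  have gp : ∀ x : ℝ, 0 < x → Real.Gamma x ≠ 0 := fun x hx => (Real.Gamma_pos_of_pos hx).ne'
  have hl := ((((g (3/2)).pow 2).mul (g (5/3))).mul (g (2/3))).div
    (((g 2).mul (g 1)).mul ((g (7/6)).pow 2))
    (mul_ne_zero (mul_ne_zero (gp 2 (by norm_num)) (gp 1 (by norm_num)))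
      (pow_ne_zero 2 (gp (7/6) (by norm_num))))
  have hP : Tendsto (fun n : ℕ => ∏ j ∈ Finset.range (n + 1), rho (1 + j)) atTop _ :=
    hl.congr' (by
      filter_upwards [eventually_gt_atTop 0] with n hn
      exact (prod_rho n hn).symm)
  have hW := hP.mul ((tendsto_add_atTop_iff_nat 1).2 W_tend)
  have hc : Tendsto (fun _ : ℕ => ∑' k, T 1 k) atTop (𝓝 (∑' k, T 1 k)) := tendsto_const_nhds
  have := tendsto_nhds_unique (hc.congr (fun m => W_iter (m + 1))) hW
  rw [this]
  have e1 : Real.Gamma (3/2) = 1/2 * √π := by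
    rw [show (3/2:ℝ) = 1/2 + 1 by norm_num, Real.Gamma_add_one (by norm_num), Real.Gamma_one_half_eq]
  have e2 : Real.Gamma (5/3) = 2/3 * Real.Gamma (2/3) := by
    rw [show (5/3:ℝ) = 2/3 + 1 by norm_num, Real.Gamma_add_one (by norm_num)]
  have e3 : Real.Gamma (7/6) = 1/6 * Real.Gamma (1/6) := by
    rw [show (7/6:ℝ) = 1/6 + 1 by norm_num, Real.Gamma_add_one (by norm_num)]
  have h6 := gp (1/6) (by norm_num)
  rw [e1, e2, e3, Real.Gamma_two, Real.Gamma_one, mul_pow, Real.sq_sqrt Real.pi_pos.le]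
  field_simp
  norm_num

lemma term_eq (n : ℕ) : FF n 0 * (4 / (3 * n + 2) ^ 2) = (-1/27 : ℝ) ^ n *
      (poch 1 n * poch (1/2) n * poch (1/3) n / poch (5/3) n ^ 3) := by
  have hp : ∀ m : ℕ, poch (5/3) m ≠ 0 := fun m =>
    (Finset.prod_pos (fun j _ => by positivity)).ne'
  induction n with
  | zero => simp [FF, f0, poch]; norm_num
  | succ n ih =>
    have hs : ∀ x, poch x (n + 1) = poch x n * (x + n) := fun x => Finset.prod_range_succ _ _
    have h5 := hp n
    have key : (-1/27 : ℝ) ^ (n + 1) *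
      (poch 1 (n + 1) * poch (1/2) (n + 1) * poch (1/3) (n + 1) / poch (5/3) (n + 1) ^ 3) =
      ((-1/27 : ℝ) ^ n * (poch 1 n * poch (1/2) n * poch (1/3) n / poch (5/3) n ^ 3)) *
      ((-1/27) * ((1 + n) * (1/2 + n) * (1/3 + n) / (5/3 + n) ^ 3)) := by
      simp only [hs, pow_succ]
      field_simp
    rw [key, ← ih, FF_succ]
    unfold rr
    push_cast
    field_simp
    ring

end Aux48

open Aux48

theorem series_48pi_gamma :
    48 * π * Real.Gamma (2/3) ^ 2 / Real.Gamma (1/6) ^ 2 = ∑' n : ℕ, (-1/27 : ℝ) ^ n *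
      (poch 1 n * poch (1/2) n * poch (1/3) n / poch (5/3) n ^ 3) *
      (9 + 28 * n + 21 * (n : ℝ) ^ 2) := by
  have hsum : Summable f0 := (T_summable 1 le_rfl).congr T_one
  have h1 : ∑' k, f0 k = ∑' n, GG n 0 :=
    tendsto_nhds_unique hsum.hasSum.tendsto_sum_nat S_eq
  have h2 : ∀ n : ℕ, (-1/27 : ℝ) ^ n *
      (poch 1 n * poch (1/2) n * poch (1/3) n / poch (5/3) n ^ 3) *
      (9 + 28 * n + 21 * (n : ℝ) ^ 2) = 8 * GG n 0 := by
    intro n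
    rw [← term_eq]
    unfold GG
    push_cast
    field_simp
    ring
  rw [tsum_congr h2, tsum_mul_left, ← h1, dixon]
  ring
end
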